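/- (Duality) For every E ∈ ℂ and every z ∈ ℂ with z ≠ 0: det(z·I_{2m} − T(E)) = (−z)^m · det(E·I_{nm} − H(z)) / (det B_1 ⋯ det B_n). -/

import Mathlib

open Matrix

noncomputable def tstep {m : ℕ} (A B C : Matrix (Fin m) (Fin m) ℂ) (E : ℂ) :
    Matrix (Fin m ⊕ Fin m) (Fin m ⊕ Fin m) ℂ :=
  Matrix.fromBlocks (B⁻¹ * (E • 1 - A)) (-(B⁻¹ * C)) 1 0

/-- The transfer matrix `T(E) = t_n(E) ⋯ t_1(E)` (0-indexed: `t_{n-1} ⋯ t_0`). -/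
noncomputable def transfer {n m : ℕ} (A B C : Fin n → Matrix (Fin m) (Fin m) ℂ) (E : ℂ) :
    Matrix (Fin m ⊕ Fin m) (Fin m ⊕ Fin m) ℂ :=
  ((List.ofFn fun k : Fin n => tstep (A k) (B k) (C k) E).reverse).prod

/-- The block matrix `H(z)` with Bloch-type boundary conditions:
diagonal blocks `A_k`, upper blocks `B_k`, lower blocks `C_k`,
corner blocks `z⁻¹ C_1` (top-right) and `z B_n` (bottom-left). -/
noncomputable def Hmat {n m : ℕ} (A B C : Fin n → Matrix (Fin m) (Fin m) ℂ) (z : ℂ) :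
    Matrix (Fin n × Fin m) (Fin n × Fin m) ℂ :=
  fun p q =>
    (if p.1 = q.1 then A p.1 p.2 q.2 else 0)
    + (if (p.1 : ℕ) + 1 = (q.1 : ℕ) then B p.1 p.2 q.2 else 0)
    + (if (q.1 : ℕ) + 1 = (p.1 : ℕ) then C p.1 p.2 q.2 else 0)
    + (if (p.1 : ℕ) = 0 ∧ (q.1 : ℕ) = n - 1 then z⁻¹ * C p.1 p.2 q.2 else 0)
    + (if (p.1 : ℕ) = n - 1 ∧ (q.1 : ℕ) = 0 then z * B p.1 p.2 q.2 else 0)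

namespace Dual

noncomputable def Q {n m : ℕ} (A B C : Fin n → Matrix (Fin m) (Fin m) ℂ) (E : ℂ) :
    ℕ → Matrix (Fin m ⊕ Fin m) (Fin m ⊕ Fin m) ℂ
  | 0 => 1
  | k + 1 => (if h : k < n then tstep (A ⟨k, h⟩) (B ⟨k, h⟩) (C ⟨k, h⟩) E else 1) * Q A B C E k

theorem transfer_eq {n m : ℕ} (A B C : Fin n → Matrix (Fin m) (Fin m) ℂ) (E : ℂ) :
    transfer A B C E = Q A B C E n := by
  have key : ∀ k, (hk : k ≤ n) → Q A B C E k =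
      ((List.ofFn fun i : Fin k => tstep (A (i.castLE hk)) (B (i.castLE hk))
        (C (i.castLE hk)) E).reverse).prod := by
    intro k
    induction k with
    | zero => intro _; simp [Q]
    | succ k ih =>
      intro hk
      have hk' : k < n := hk
      rw [List.ofFn_succ', Q, ih hk'.le]
      simp [hk']
      rfl
  rw [key n le_rfl]
  rfl

noncomputable def L {n m : ℕ} (A B C : Fin n → Matrix (Fin m) (Fin m) ℂ) (E : ℂ) :
    Matrix (Fin n × Fin m) (Fin n × Fin m) ℂ := fun p q =>
  (if (q.1 : ℕ) + 0 = (p.1 : ℕ) then - B p.1 p.2 q.2 else 0)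
  + (if (q.1 : ℕ) + 1 = (p.1 : ℕ) then (E • (1 : Matrix (Fin m) (Fin m) ℂ) - A p.1) p.2 q.2 else 0)
  + (if (q.1 : ℕ) + 2 = (p.1 : ℕ) then - C p.1 p.2 q.2 else 0)

noncomputable def R {n m : ℕ} (A C : Fin n → Matrix (Fin m) (Fin m) ℂ) (E : ℂ) :
    Matrix (Fin n × Fin m) (Fin m ⊕ Fin m) ℂ := fun p => Sum.elim
  (fun j => (if (p.1 : ℕ) = 0 then (E • (1 : Matrix (Fin m) (Fin m) ℂ) - A p.1) p.2 j else 0)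
    + (if (p.1 : ℕ) = 1 then - C p.1 p.2 j else 0))
  (fun j => if (p.1 : ℕ) = 0 then - C p.1 p.2 j else 0)

def S (n m : ℕ) : Matrix (Fin m ⊕ Fin m) (Fin n × Fin m) ℂ := Sum.elim
  (fun i q => if (q.1 : ℕ) + 1 = n ∧ i = q.2 then 1 else 0)
  (fun i q => if (q.1 : ℕ) + 2 = n ∧ i = q.2 then 1 else 0)

noncomputable def W {n m : ℕ} (A B C : Fin n → Matrix (Fin m) (Fin m) ℂ) (E : ℂ) :
    Matrix (Fin n × Fin m) (Fin m ⊕ Fin m) ℂ := fun p j => Q A B C E ((p.1 : ℕ) + 1) (Sum.inl p.2) j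

theorem sum_shift {n : ℕ} (G : ℕ → ℂ) (d p : ℕ) (hp : p < n + d) :
    ∑ x : Fin n, (if (x : ℕ) + d = p then G x else 0) = if d ≤ p then G (p - d) else 0 := by
  split_ifs with h
  · rw [Finset.sum_eq_single (⟨p - d, by omega⟩ : Fin n)]
    · simp [h]
    · intro b _ hb
      rw [if_neg]
      intro h'
      apply hb
      ext
      simp
      omega
    · simp
  · apply Finset.sum_eq_zero
    intro x _
    rw [if_neg]; omega

theorem Q_inr {n m : ℕ} (A B C : Fin n → Matrix (Fin m) (Fin m) ℂ) (E : ℂ) (k : ℕ) (hk : k < n)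
    (i : Fin m) (j) : Q A B C E (k + 1) (Sum.inr i) j = Q A B C E k (Sum.inl i) j := by
  simp [Q, hk, tstep, Matrix.mul_apply, Fintype.sum_sum_type, Matrix.one_apply]

theorem Q_inl {n m : ℕ} (A B C : Fin n → Matrix (Fin m) (Fin m) ℂ) (hB : ∀ k, IsUnit (B k))
    (E : ℂ) (k : Fin n) (i : Fin m) (j) :
    ∑ l, B k i l * Q A B C E (k + 1) (Sum.inl l) j =
      ∑ l, (E • (1 : Matrix (Fin m) (Fin m) ℂ) - A k) i l * Q A B C E k (Sum.inl l) j
      - ∑ l, C k i l * Q A B C E k (Sum.inr l) j := by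
  have hu : B k * (B k)⁻¹ = 1 := Matrix.mul_nonsing_inv _ ((Matrix.isUnit_iff_isUnit_det _).1 (hB k))
  set X : Matrix (Fin m) (Fin m ⊕ Fin m) ℂ := fun l j => Q A B C E k (Sum.inl l) j
  set Y : Matrix (Fin m) (Fin m ⊕ Fin m) ℂ := fun l j => Q A B C E k (Sum.inr l) j
  set V : Matrix (Fin m) (Fin m ⊕ Fin m) ℂ := fun l j => Q A B C E (k + 1) (Sum.inl l) j
  have hV : V = (B k)⁻¹ * (E • 1 - A k) * X - (B k)⁻¹ * C k * Y := by
    ext l j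
    have h0 : V l j = (tstep (A k) (B k) (C k) E * Q A B C E k) (Sum.inl l) j := by
      simp [V, Q, k.2]
    rw [h0, Matrix.mul_apply, Fintype.sum_sum_type, Matrix.sub_apply, Matrix.mul_apply,
      Matrix.mul_apply (N := Y)]
    simp only [tstep, Matrix.fromBlocks_apply₁₁, Matrix.fromBlocks_apply₁₂, X, Y, Matrix.neg_apply,
      neg_mul, Finset.sum_neg_distrib, sub_eq_add_neg]
  have h : B k * V = (E • 1 - A k) * X - C k * Y := by
    rw [hV, Matrix.mul_sub, Matrix.mul_assoc, Matrix.mul_assoc, ← Matrix.mul_assoc (B k),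
      ← Matrix.mul_assoc (B k), hu, Matrix.one_mul, Matrix.one_mul]
  have := congrFun (congrFun h i) j
  simpa only [Matrix.mul_apply, Matrix.sub_apply] using this

theorem LW {n m : ℕ} (A B C : Fin n → Matrix (Fin m) (Fin m) ℂ) (hB : ∀ k, IsUnit (B k))
    (E : ℂ) : R A C E + L A B C E * W A B C E = 0 := by
  ext ⟨k, i⟩ j
  have hQ := Q_inl A B C hB E k i j
  have hk := k.2
  have e : (L A B C E * W A B C E) (k, i) j =
      ∑ l, ∑ x : Fin n, (
      (if (x : ℕ) + 0 = k then (fun x => - B k i l * Q A B C E (x + 1) (Sum.inl l) j) (x : ℕ) else 0)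
      + (if (x : ℕ) + 1 = k then (fun x => (E • (1 : Matrix (Fin m) (Fin m) ℂ) - A k) i l * Q A B C E (x + 1) (Sum.inl l) j) (x : ℕ) else 0)
      + (if (x : ℕ) + 2 = k then (fun x => - C k i l * Q A B C E (x + 1) (Sum.inl l) j) (x : ℕ) else 0)) := by
    rw [Matrix.mul_apply, Fintype.sum_prod_type_right]
    refine Finset.sum_congr rfl fun l _ => Finset.sum_congr rfl fun x _ => ?_
    simp only [L, W, add_mul, ite_mul, zero_mul]
  rw [Matrix.add_apply, e]
  simp only [Finset.sum_add_distrib]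
  simp only [fun l => sum_shift (n := n) (fun x => - B k i l * Q A B C E (x + 1) (Sum.inl l) j) 0 k (by omega),
    fun l => sum_shift (n := n) (fun x => (E • (1 : Matrix (Fin m) (Fin m) ℂ) - A k) i l * Q A B C E (x + 1) (Sum.inl l) j) 1 k (by omega),
    fun l => sum_shift (n := n) (fun x => - C k i l * Q A B C E (x + 1) (Sum.inl l) j) 2 k (by omega)]
  simp only [Nat.zero_le, if_true, Nat.sub_zero, neg_mul, Finset.sum_neg_distrib, hQ, Matrix.zero_apply]
  obtain ⟨k, hk⟩ := k
  rcases k with _ | _ | k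
  · rcases j with j | j <;> simp [R, Q, Matrix.one_apply]
  · have h1 := fun l => Q_inr A B C E 0 (by omega) l j
    simp only [zero_add] at h1
    rcases j with j | j <;> simp [R, h1] <;> simp [Q, Matrix.one_apply]
  · have h1 := fun l => Q_inr A B C E (k+1) (by omega) l j
    rcases j with j | j <;> simp [R, h1]

theorem SW {n m : ℕ} (hn : 2 ≤ n) (A B C : Fin n → Matrix (Fin m) (Fin m) ℂ)
    (E : ℂ) : S n m * W A B C E = transfer A B C E := by
  rw [transfer_eq]
  ext i j
  rw [Matrix.mul_apply, Fintype.sum_prod_type]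
  rcases i with i | i
  · simp only [S, W, Sum.elim_inl, ite_and, ite_mul, one_mul, zero_mul, Finset.sum_ite_irrel,
      Finset.sum_const_zero, Finset.sum_ite_eq, Finset.mem_univ, if_true]
    rw [sum_shift (fun x => Q A B C E (x + 1) (Sum.inl i) j) 1 n (by omega), if_pos (by omega)]
    rw [Nat.sub_add_cancel (by omega)]
  · simp only [S, W, Sum.elim_inr, ite_and, ite_mul, one_mul, zero_mul, Finset.sum_ite_irrel,
      Finset.sum_const_zero, Finset.sum_ite_eq, Finset.mem_univ, if_true]
    rw [sum_shift (fun x => Q A B C E (x + 1) (Sum.inl i) j) 2 n (by omega), if_pos (by omega)]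
    obtain ⟨k, rfl⟩ := Nat.exists_eq_add_of_le' hn
    rw [Q_inr A B C E (k + 1) (by omega)]
    rfl

theorem det_L {n m : ℕ} (A B C : Fin n → Matrix (Fin m) (Fin m) ℂ) (E : ℂ) :
    (L A B C E).det = (-1) ^ (n * m) * ∏ k, (B k).det := by
  have hT : (L A B C E).BlockTriangular (fun p => OrderDual.toDual p.1) := by
    intro p q h
    have h' : (p.1 : ℕ) < q.1 := h
    simp only [L]
    rw [if_neg (by omega), if_neg (by omega), if_neg (by omega)]
    simp
  rw [hT.det_fintype]
  have : ∀ k : Fin n, ((L A B C E).toSquareBlock (fun p => OrderDual.toDual p.1)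
      (OrderDual.toDual k)).det = (-1) ^ m * (B k).det := by
    intro k
    let e : Fin m ≃ {p : Fin n × Fin m // OrderDual.toDual p.1 = OrderDual.toDual k} :=
      { toFun := fun i => ⟨(k, i), rfl⟩
        invFun := fun p => p.1.2
        left_inv := fun i => rfl
        right_inv := by
          rintro ⟨⟨a, b⟩, h⟩
          have : a = k := h
          subst this
          rfl }
    rw [← Matrix.det_submatrix_equiv_self e]
    have : ((L A B C E).toSquareBlock (fun p => OrderDual.toDual p.1)
      (OrderDual.toDual k)).submatrix e e = - B k := by
      ext i j
      simp [Matrix.toSquareBlock_def, e, L]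
    rw [this, Matrix.det_neg, Fintype.card_fin]
  rw [← OrderDual.toDual.prod_comp]
  simp only [this]
  rw [Finset.prod_mul_distrib]
  simp [← pow_mul, mul_comm]

set_option maxHeartbeats 4000000 in
theorem LRS {n m : ℕ} (A B C : Fin (n + 2) → Matrix (Fin m) (Fin m) ℂ) (E z : ℂ) (hz : z ≠ 0) :
    L A B C E + z⁻¹ • (R A C E * S (n + 2) m) = Matrix.of fun p q =>
      (if q.1 = Fin.last (n + 1) then z⁻¹ else 1) *
      ((E • (1 : Matrix (Fin (n + 2) × Fin m) (Fin (n + 2) × Fin m) ℂ) - Hmat A B C z).submatrix id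
        (Equiv.prodCongrLeft fun _ : Fin m => finRotate (n + 2))) p q := by
  ext ⟨p, i⟩ ⟨q, j⟩
  have hRS : (R A C E * S (n + 2) m) (p, i) (q, j) =
      (if (q : ℕ) = n + 1 then R A C E (p, i) (Sum.inl j) else 0) +
      (if (q : ℕ) = n then R A C E (p, i) (Sum.inr j) else 0) := by
    rw [Matrix.mul_apply, Fintype.sum_sum_type]
    simp [S, ite_and]
  rw [Matrix.add_apply, Matrix.smul_apply, hRS]
  simp only [Matrix.of_apply, Matrix.submatrix_apply, id, Equiv.prodCongrLeft_apply,
    Matrix.sub_apply, Matrix.smul_apply, Hmat, L, R, Sum.elim_inl, Sum.elim_inr, smul_eq_mul,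
    Matrix.one_apply, Prod.mk.injEq]
  obtain ⟨p, hp⟩ := p
  obtain ⟨q, hq⟩ := q
  by_cases hl : q = n + 1
  · subst hl
    have : finRotate (n + 2) ⟨n + 1, hq⟩ = 0 := finRotate_last
    simp only [this]
    simp only [Fin.ext_iff, Fin.val_last, Fin.val_zero]
    clear this hRS
    generalize A ⟨p, hp⟩ i j = a
    generalize B ⟨p, hp⟩ i j = b
    generalize C ⟨p, hp⟩ i j = c
    have hzz : z⁻¹ * z = 1 := inv_mul_cancel₀ hz
    split_ifs <;> first | omega | (exfalso; omega) | grind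
  · have : finRotate (n + 2) ⟨q, hq⟩ = ⟨q + 1, by omega⟩ := finRotate_of_lt (by omega)
    simp only [this]
    simp only [Fin.ext_iff, Fin.val_last, Fin.val_zero]
    clear this hRS
    generalize A ⟨p, hp⟩ i j = a
    generalize B ⟨p, hp⟩ i j = b
    generalize C ⟨p, hp⟩ i j = c
    have hzz : z⁻¹ * z = 1 := inv_mul_cancel₀ hz
    split_ifs <;> first | omega | (exfalso; omega) | grind

theorem det_LRS {n m : ℕ} (A B C : Fin (n + 2) → Matrix (Fin m) (Fin m) ℂ) (E z : ℂ) (hz : z ≠ 0) :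
    (L A B C E + z⁻¹ • (R A C E * S (n + 2) m)).det = z⁻¹ ^ m * ((-1) ^ ((n + 1) * m) *
      (E • (1 : Matrix (Fin (n + 2) × Fin m) (Fin (n + 2) × Fin m) ℂ) - Hmat A B C z).det) := by
  rw [LRS _ _ _ _ _ hz, Matrix.det_mul_row (fun q : Fin (n + 2) × Fin m =>
    if q.1 = Fin.last (n + 1) then z⁻¹ else 1), Matrix.det_permute', Equiv.Perm.sign_prodCongrLeft]
  congr 1
  · rw [Fintype.prod_prod_type_right]
    simp
  · simp [sign_finRotate, ← pow_mul]

end Dual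

/-- Duality: `det (z·1 - T(E)) = (-z)^m · det (E·1 - H(z)) / (det B_1 ⋯ det B_n)`. -/
theorem stmt4 {n m : ℕ} (hn : 2 ≤ n) (hm : 1 ≤ m)
    (A B C : Fin n → Matrix (Fin m) (Fin m) ℂ)
    (hB : ∀ k, IsUnit (B k)) (hC : ∀ k, IsUnit (C k)) (E z : ℂ) (hz : z ≠ 0) :
    (z • (1 : Matrix (Fin m ⊕ Fin m) (Fin m ⊕ Fin m) ℂ) - transfer A B C E).det =
      (-z) ^ m * (E • (1 : Matrix (Fin n × Fin m) (Fin n × Fin m) ℂ) - Hmat A B C z).det /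
        ∏ k, (B k).det := by
  obtain ⟨n, rfl⟩ := Nat.exists_eq_add_of_le' hn
  set T := transfer A B C E with hT
  set K := E • (1 : Matrix (Fin (n + 2) × Fin m) (Fin (n + 2) × Fin m) ℂ) - Hmat A B C z with hK
  set S' := Dual.S (n + 2) m with hS
  set R' := Dual.R A C E with hR
  set L' := Dual.L A B C E with hL
  set W' := Dual.W A B C E with hW
  set Z : Matrix (Fin m ⊕ Fin m) (Fin m ⊕ Fin m) ℂ := -(z • 1) with hZ
  have hdet : ∏ k, (B k).det ≠ 0 := by
    rw [Finset.prod_ne_zero_iff]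
    intro k _
    exact ((Matrix.isUnit_iff_isUnit_det _).1 (hB k)).ne_zero
  have h1 : fromBlocks Z S' R' L' * fromBlocks 1 0 W' 1 = fromBlocks (-(z • 1 - T)) S' 0 L' := by
    rw [Matrix.fromBlocks_multiply]
    simp only [Matrix.mul_one, Matrix.mul_zero, zero_add]
    rw [hR, hL, hW, Dual.LW A B C hB E, hS, Dual.SW hn]
    congr 1
    rw [hZ, neg_sub]; abel
  have h2 : fromBlocks Z S' R' L' * fromBlocks 1 (z⁻¹ • S') 0 1 =
      fromBlocks Z 0 R' (L' + z⁻¹ • (R' * S')) := by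
    rw [Matrix.fromBlocks_multiply]
    simp only [Matrix.mul_one, Matrix.mul_zero, add_zero]
    congr 1
    · simp [hZ, smul_smul, hz]
    · rw [Matrix.mul_smul]; exact add_comm _ _
  have d1 := congrArg Matrix.det h1
  have d2 := congrArg Matrix.det h2
  rw [Matrix.det_mul, Matrix.det_fromBlocks_zero₁₂, Matrix.det_fromBlocks_zero₂₁, Matrix.det_neg,
    Matrix.det_one, Matrix.det_one, mul_one, mul_one, Dual.det_L] at d1
  rw [Matrix.det_mul, Matrix.det_fromBlocks_zero₂₁, Matrix.det_fromBlocks_zero₁₂,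
    Matrix.det_one, Matrix.det_one, mul_one, mul_one, Dual.det_LRS _ _ _ _ _ hz, d1, hZ,
    Matrix.det_neg, Matrix.det_smul, Matrix.det_one, ← hK] at d2
  rw [eq_div_iff hdet]
  simp only [Fintype.card_sum, Fintype.card_fin, mul_one] at d2
  have e2 : ((-1 : ℂ) ^ (m + m)) = 1 := Even.neg_one_pow ⟨m, rfl⟩
  have e3 : ((-1 : ℂ) ^ ((n + 2) * m)) = (-1) ^ ((n + 1) * m) * (-1) ^ m := by
    rw [← pow_add]; congr 1; ring
  have e4 : ((-1 : ℂ) ^ ((n + 1) * m)) ≠ 0 := pow_ne_zero _ (by norm_num)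
  have e5 : ((-1 : ℂ) ^ m) * (-1) ^ m = 1 := by rw [← pow_add, e2]
  have e6 : z ^ m * z⁻¹ ^ m = 1 := by rw [← mul_pow, mul_inv_cancel₀ hz, one_pow]
  rw [e2, e3, pow_add] at d2
  rw [neg_pow]
  apply mul_left_cancel₀ e4
  linear_combination (-1) ^ m * d2 + (-1)^((n+1)*m) * ((-1) ^ m * z ^ m * K.det * e6 - (z • 1 - T).det * (∏ k, (B k).det) * e5)
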